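/- Let F = ℤ/2ℤ and R = F[U] the polynomial ring. Let C be a bounded chain complex of finitely generated free R-modules. Set C^∞ = C[U^{-1}] (the localization inverting U), C^+ = C^∞/C, and Ĉ = C/UC, and let ι̂_C : H_*(Ĉ) → H_*(C^+) be the map induced by the injective chain map Ĉ → C^+ sending c + UC to U^{-1}c + C, whose image is ker(U : C^+ → C^+). Define H_red(C) to be the cokernel of the natural map H_*(C^∞) → H_*(C^+). Let D = Hom_R(C, R) be the R-dual complex (again a bounded complex of finitely generated free R-modules), with the analogous constructions D^∞, D^+, D̂, ι̂_D and H_red(D), and let ⟨·,·⟩ : H_*(D̂) × H_*(Ĉ) → F denote the Kronecker pairing induced by the natural identification D/UD ≅ Hom_F(C/UC, F). Then for every x ∈ H_*(D̂): the image of ι̂_D(x) in H_red(D) is nonzero if and only if there exists y ∈ H_*(Ĉ) with ⟨x, y⟩ ≠ 0 and ι̂_C(y) = 0 in H_*(C^+). -/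

import Mathlib

noncomputable section

open Polynomial

/-- `F = ℤ/2ℤ` and `R = F[U]`, with `U = X` the polynomial variable. -/
abbrev Rp : Type := Polynomial (ZMod 2)

/-- The multiplicative set of powers of `U`. -/
abbrev Sx : Submonoid Rp := Submonoid.powers (X : Rp)

/-- `U` as an element of `Sx`. -/
def sU : Sx := ⟨X, Submonoid.mem_powers _⟩

section Hmod

variable {R : Type} [CommRing R]

/-- Homology of a three-term window `M --d1--> N --d0--> P` of a chain complex. -/
abbrev Hmod {M N P : Type}
    [AddCommGroup M] [Module R M] [AddCommGroup N] [Module R N]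
    [AddCommGroup P] [Module R P]
    (d1 : M →ₗ[R] N) (d0 : N →ₗ[R] P) : Type :=
  ↥(LinearMap.ker d0) ⧸ Submodule.comap (LinearMap.ker d0).subtype (LinearMap.range d1)

/-- The homology class of a cycle. -/
def Hmod.mk {M N P : Type}
    [AddCommGroup M] [Module R M] [AddCommGroup N] [Module R N]
    [AddCommGroup P] [Module R P]
    (d1 : M →ₗ[R] N) (d0 : N →ₗ[R] P) (x : N) (hx : x ∈ LinearMap.ker d0) :
    Hmod d1 d0 :=
  Submodule.Quotient.mk ⟨x, hx⟩

/-- The map on homology induced by a chain map (given on a three-term window by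
`fM, fN, fP` together with the two commuting squares). -/
def HmodMap {M N P M' N' P' : Type}
    [AddCommGroup M] [Module R M] [AddCommGroup N] [Module R N] [AddCommGroup P] [Module R P]
    [AddCommGroup M'] [Module R M'] [AddCommGroup N'] [Module R N']
    [AddCommGroup P'] [Module R P']
    {d1 : M →ₗ[R] N} {d0 : N →ₗ[R] P} {d1' : M' →ₗ[R] N'} {d0' : N' →ₗ[R] P'}
    (fM : M →ₗ[R] M') (fN : N →ₗ[R] N') (fP : P →ₗ[R] P')
    (h1 : fN ∘ₗ d1 = d1' ∘ₗ fM) (h0 : fP ∘ₗ d0 = d0' ∘ₗ fN) :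
    Hmod d1 d0 →ₗ[R] Hmod d1' d0' :=
  Submodule.mapQ _ _
    (fN.restrict (p := LinearMap.ker d0) (q := LinearMap.ker d0')
      (fun x hx => by
        have h := LinearMap.congr_fun h0 x
        simp only [LinearMap.comp_apply] at h
        simp only [LinearMap.mem_ker] at hx ⊢
        rw [← h, hx, map_zero]))
    (by
      rintro ⟨x, hx0⟩ hx
      simp only [Submodule.mem_comap, Submodule.coe_subtype, LinearMap.mem_range] at hx ⊢
      obtain ⟨m, hm⟩ := hx
      refine ⟨fM m, ?_⟩
      have h := LinearMap.congr_fun h1 m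
      simp only [LinearMap.comp_apply] at h
      rw [← h, hm]
      rfl)

end Hmod

section Flavours

variable (M : Type) [AddCommGroup M] [Module Rp M]

/-- `C^∞ = C[U⁻¹]`, the localization inverting `U`, degreewise. -/
abbrev Loc : Type := LocalizedModule Sx M

/-- `C ⊆ C^∞`, degreewise. -/
abbrev toLoc : M →ₗ[Rp] Loc M := LocalizedModule.mkLinearMap Sx M

/-- `C⁺ = C^∞ / C`, degreewise. -/
abbrev CPlus : Type := Loc M ⧸ LinearMap.range (toLoc M)

/-- The submodule `U·M ⊆ M`. -/
abbrev USub : Submodule Rp M := LinearMap.range ((X : Rp) • (LinearMap.id : M →ₗ[Rp] M))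

/-- `Ĉ = C/UC`, degreewise. -/
abbrev CHat : Type := M ⧸ USub M

/-- Projection `C^∞ → C⁺`, degreewise. -/
abbrev projPlus : Loc M →ₗ[Rp] CPlus M := Submodule.mkQ _

variable {M}
variable {N : Type} [AddCommGroup N] [Module Rp N]

/-- A linear map induces a map on localizations. -/
def locMap (f : M →ₗ[Rp] N) : Loc M →ₗ[Rp] Loc N :=
  IsLocalizedModule.map Sx (toLoc M) (toLoc N) f

lemma locMap_mk (f : M →ₗ[Rp] N) (m : M) (s : Sx) :
    locMap f (LocalizedModule.mk m s) = LocalizedModule.mk (f m) s := by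
  rw [IsLocalizedModule.mk_eq_mk', IsLocalizedModule.mk_eq_mk', locMap,
    IsLocalizedModule.map_mk']

/-- A linear map induces a map `C⁺ → N⁺`. -/
def plusMap (f : M →ₗ[Rp] N) : CPlus M →ₗ[Rp] CPlus N :=
  Submodule.mapQ _ _ (locMap f) (by
    rintro x ⟨m, rfl⟩
    refine ⟨f m, ?_⟩
    simp only [LocalizedModule.mkLinearMap_apply, locMap_mk])

/-- A linear map induces a map `Ĉ → N̂`. -/
def hatMap (f : M →ₗ[Rp] N) : CHat M →ₗ[Rp] CHat N :=
  Submodule.mapQ _ _ f (by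
    rintro x ⟨m, rfl⟩
    refine ⟨f m, ?_⟩
    simp only [LinearMap.smul_apply, LinearMap.id_coe, id_eq, map_smul])

/-- The chain-level map `M → C^∞` given by `c ↦ U⁻¹ c`. -/
def jmap : M →ₗ[Rp] Loc M := (LocalizedModule.divBy sU) ∘ₗ (toLoc M)

lemma jmap_apply (m : M) : jmap m = LocalizedModule.mk m sU := by
  simp only [jmap, LinearMap.comp_apply, LocalizedModule.mkLinearMap_apply,
    LocalizedModule.divBy_apply, LocalizedModule.liftOn_mk, one_mul]

/-- The chain map `ι̂ : Ĉ → C⁺`, `c + UC ↦ U⁻¹ c + C`. -/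
def iotaHat : CHat M →ₗ[Rp] CPlus M :=
  Submodule.liftQ _ ((projPlus M) ∘ₗ jmap) (by
    rintro x ⟨m, rfl⟩
    simp only [LinearMap.mem_ker, LinearMap.comp_apply, LinearMap.smul_apply,
      LinearMap.id_coe, id_eq, jmap_apply]
    rw [Submodule.mkQ_apply, Submodule.Quotient.mk_eq_zero]
    refine ⟨m, ?_⟩
    simp only [LocalizedModule.mkLinearMap_apply]
    rw [LocalizedModule.mk_eq]
    exact ⟨1, by simp [sU, Submonoid.smul_def]⟩)

end Flavours

section Squares

variable {M N : Type} [AddCommGroup M] [Module Rp M] [AddCommGroup N] [Module Rp N]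

/-- `ι̂` is a chain map: it commutes with the induced differentials. -/
lemma iota_square (f : M →ₗ[Rp] N) :
    iotaHat ∘ₗ hatMap f = plusMap f ∘ₗ iotaHat := by
  apply Submodule.linearMap_qext
  ext m
  simp only [LinearMap.comp_apply, Submodule.mkQ_apply]
  rw [hatMap, Submodule.mapQ_apply, iotaHat, Submodule.liftQ_apply, iotaHat,
    Submodule.liftQ_apply]
  simp only [LinearMap.comp_apply, jmap_apply, Submodule.mkQ_apply]
  rw [plusMap, Submodule.mapQ_apply, locMap_mk]

/-- The projection `C^∞ → C⁺` is a chain map. -/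
lemma proj_square (f : M →ₗ[Rp] N) :
    projPlus N ∘ₗ locMap f = plusMap f ∘ₗ projPlus M :=
  (Submodule.mapQ_mkQ _ _ (locMap f)).symm

end Squares

section Hmod

variable {R M N P M' N' P' : Type} [CommRing R]
  [AddCommGroup M] [Module R M] [AddCommGroup N] [Module R N] [AddCommGroup P] [Module R P]
  [AddCommGroup M'] [Module R M'] [AddCommGroup N'] [Module R N']
  [AddCommGroup P'] [Module R P']

lemma Hmod.mk_eq_mk_iff {d1 : M →ₗ[R] N} {d0 : N →ₗ[R] P} {x y : N}
    (hx : x ∈ LinearMap.ker d0) (hy : y ∈ LinearMap.ker d0) :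
    Hmod.mk d1 d0 x hx = Hmod.mk d1 d0 y hy ↔ ∃ m, d1 m = x - y :=
  Submodule.Quotient.eq _

lemma Hmod.mk_eq_zero_iff {d1 : M →ₗ[R] N} {d0 : N →ₗ[R] P} {x : N}
    (hx : x ∈ LinearMap.ker d0) :
    Hmod.mk d1 d0 x hx = 0 ↔ ∃ m, d1 m = x :=
  Submodule.Quotient.mk_eq_zero _

lemma HmodMap_mk {d1 : M →ₗ[R] N} {d0 : N →ₗ[R] P} {d1' : M' →ₗ[R] N'} {d0' : N' →ₗ[R] P'}
    (fM : M →ₗ[R] M') (fN : N →ₗ[R] N') (fP : P →ₗ[R] P')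
    (h1 : fN ∘ₗ d1 = d1' ∘ₗ fM) (h0 : fP ∘ₗ d0 = d0' ∘ₗ fN)
    (x : N) (hx : x ∈ LinearMap.ker d0) (hx' : fN x ∈ LinearMap.ker d0') :
    HmodMap fM fN fP h1 h0 (Hmod.mk d1 d0 x hx) = Hmod.mk d1' d0' (fN x) hx' :=
  rfl

lemma mem_ker_of_commutes {d0 : N →ₗ[R] P} {d0' : N' →ₗ[R] P'} {fN : N →ₗ[R] N'}
    {fP : P →ₗ[R] P'} (h0 : fP ∘ₗ d0 = d0' ∘ₗ fN) {x : N} (hx : x ∈ LinearMap.ker d0) :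
    fN x ∈ LinearMap.ker d0' := by
  have h := LinearMap.congr_fun h0 x
  rw [LinearMap.comp_apply, LinearMap.mem_ker.mp hx, map_zero] at h
  exact h.symm

end Hmod

section Flavours

variable {M N P : Type} [AddCommGroup M] [Module Rp M] [AddCommGroup N] [Module Rp N]
  [AddCommGroup P] [Module Rp P]

lemma X_smul_jmap (m : M) : (X : Rp) • jmap m = toLoc M m := by
  rw [jmap_apply, LocalizedModule.mkLinearMap_apply, LocalizedModule.smul'_mk]
  exact LocalizedModule.mk_cancel sU m

lemma locMap_toLoc (f : M →ₗ[Rp] N) (m : M) : locMap f (toLoc M m) = toLoc N (f m) := by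
  simp only [LocalizedModule.mkLinearMap_apply, locMap_mk]

lemma X_pow_smul_loc_injective (k : ℕ) {x y : Loc M}
    (h : (X ^ k : Rp) • x = (X ^ k : Rp) • y) : x = y :=
  IsLocalizedModule.smul_injective (toLoc M) (⟨X ^ k, k, rfl⟩ : Sx) h

lemma toLoc_injective [Module.IsTorsionFree Rp M] : Function.Injective (toLoc M) := by
  intro x y h
  obtain ⟨⟨_, k, rfl⟩, hu⟩ := (IsLocalizedModule.eq_iff_exists Sx (toLoc M)).mp h
  exact smul_right_injective M (pow_ne_zero k X_ne_zero) hu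

lemma iotaHat_mk (m : M) : iotaHat (Submodule.Quotient.mk m) = projPlus M (jmap m) :=
  rfl

lemma plusMap_projPlus (f : M →ₗ[Rp] N) (x : Loc M) :
    plusMap f (projPlus M x) = projPlus N (locMap f x) :=
  rfl

lemma projPlus_eq_iff {x y : Loc M} :
    projPlus M x = projPlus M y ↔ ∃ m, toLoc M m = x - y :=
  Submodule.Quotient.eq _

/-- `ι̂` of a class vanishes in `H_red` exactly when its cycle lifts to a cycle of the
integral complex. -/
lemma iotaHat_mem_range_iff [Module.IsTorsionFree Rp P] (f : M →ₗ[Rp] N)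
    (g : N →ₗ[Rp] P) (hgf : g ∘ₗ f = 0) (c : N)
    (hc : (Submodule.Quotient.mk c : CHat N) ∈ LinearMap.ker (hatMap g)) :
    HmodMap (d1 := hatMap f) (d0 := hatMap g) (d1' := plusMap f) (d0' := plusMap g)
        iotaHat iotaHat iotaHat (iota_square f) (iota_square g)
        (Hmod.mk (hatMap f) (hatMap g) (Submodule.Quotient.mk c) hc) ∈
      LinearMap.range (HmodMap (d1 := locMap f) (d0 := locMap g)
        (d1' := plusMap f) (d0' := plusMap g) (projPlus _) (projPlus _) (projPlus _)
        (proj_square f) (proj_square g)) ↔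
    ∃ b : N, g (c - (X : Rp) • b) = 0 := by
  have hgf' (x : Loc M) : locMap g (locMap f x) = 0 := by
    induction x using LocalizedModule.induction_on with
    | _ m s => rw [locMap_mk, locMap_mk, ← LinearMap.comp_apply, hgf, LinearMap.zero_apply,
        LocalizedModule.zero_mk]
  rw [HmodMap_mk _ _ _ _ _ _ _ (mem_ker_of_commutes (iota_square g) hc)]
  constructor
  · rintro ⟨z, hz⟩
    obtain ⟨⟨z, hz0⟩, rfl⟩ := Submodule.Quotient.mk_surjective _ z
    change HmodMap _ _ _ _ _ (Hmod.mk _ _ z hz0) = _ at hz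
    rw [HmodMap_mk _ _ _ _ _ _ _ (mem_ker_of_commutes (proj_square g) hz0),
      Hmod.mk_eq_mk_iff] at hz
    obtain ⟨w, hw⟩ := hz
    obtain ⟨w, rfl⟩ := Submodule.mkQ_surjective _ w
    rw [iotaHat_mk, plusMap_projPlus, ← map_sub, projPlus_eq_iff] at hw
    obtain ⟨b, hb⟩ := hw
    refine ⟨b, toLoc_injective ?_⟩
    have h := congrArg (fun t => (X : Rp) • locMap g t) hb
    simp only [locMap_toLoc, map_sub, hgf', LinearMap.mem_ker.mp hz0, zero_sub, neg_neg] at h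
    rw [← map_smul (locMap g), X_smul_jmap, locMap_toLoc] at h
    rw [map_sub, map_smul, map_sub, map_smul, h, sub_self, map_zero]
  · rintro ⟨b, hb⟩
    have hz0 : jmap (c - (X : Rp) • b) ∈ LinearMap.ker (locMap g) := by
      rw [LinearMap.mem_ker, jmap_apply, locMap_mk, hb, LocalizedModule.zero_mk]
    refine ⟨Hmod.mk _ _ _ hz0, ?_⟩
    rw [HmodMap_mk _ _ _ _ _ _ _ (mem_ker_of_commutes (proj_square g) hz0),
      Hmod.mk_eq_mk_iff]
    refine ⟨0, ?_⟩
    rw [map_zero, iotaHat_mk, eq_comm, sub_eq_zero, projPlus_eq_iff]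
    refine ⟨-b, ?_⟩
    rw [map_sub, map_smul, X_smul_jmap, map_neg]
    abel

/-- `ι̂` of a class vanishes in `H(C⁺)` exactly when some representative of its cycle is a
`U`-power torsion class of the integral complex. -/
lemma iotaHat_eq_zero_iff [Module.IsTorsionFree Rp N] (f : M →ₗ[Rp] N)
    (g : N →ₗ[Rp] P) (c : N)
    (hc : (Submodule.Quotient.mk c : CHat N) ∈ LinearMap.ker (hatMap g)) :
    HmodMap (d1 := hatMap f) (d0 := hatMap g) (d1' := plusMap f) (d0' := plusMap g)
        iotaHat iotaHat iotaHat (iota_square f) (iota_square g)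
        (Hmod.mk (hatMap f) (hatMap g) (Submodule.Quotient.mk c) hc) = 0 ↔
    ∃ (k : ℕ) (b : N) (a : M), f a = (X ^ k : Rp) • (c - (X : Rp) • b) := by
  rw [HmodMap_mk _ _ _ _ _ _ _ (mem_ker_of_commutes (iota_square g) hc),
    Hmod.mk_eq_zero_iff]
  constructor
  · rintro ⟨w, hw⟩
    obtain ⟨w, rfl⟩ := Submodule.mkQ_surjective _ w
    rw [iotaHat_mk, plusMap_projPlus, projPlus_eq_iff] at hw
    obtain ⟨b, hb⟩ := hw
    induction w using LocalizedModule.induction_on with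
    | _ a s =>
      obtain ⟨_, k, rfl⟩ := s
      refine ⟨k, -b, (X : Rp) • a, toLoc_injective ?_⟩
      have ha : (X ^ k : Rp) • locMap f (LocalizedModule.mk a ⟨X ^ k, k, rfl⟩) =
          toLoc N (f a) := by
        rw [locMap_mk, LocalizedModule.smul'_mk, LocalizedModule.mkLinearMap_apply]
        exact LocalizedModule.mk_cancel (⟨X ^ k, k, rfl⟩ : Sx) (f a)
      rw [eq_sub_iff_add_eq] at hb
      rw [map_smul, map_smul, ← ha, ← hb, map_smul, map_sub, map_smul, map_neg,
        ← X_smul_jmap c]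
      module
  · rintro ⟨k, b, a, h⟩
    refine ⟨projPlus M (LocalizedModule.mk a ⟨X ^ (k + 1), k + 1, rfl⟩), ?_⟩
    rw [iotaHat_mk, plusMap_projPlus, projPlus_eq_iff]
    refine ⟨-b, X_pow_smul_loc_injective (k + 1) ?_⟩
    have ha : (X ^ (k + 1) : Rp) •
        locMap f (LocalizedModule.mk a ⟨X ^ (k + 1), k + 1, rfl⟩) = toLoc N (f a) := by
      rw [locMap_mk, LocalizedModule.smul'_mk, LocalizedModule.mkLinearMap_apply]
      exact LocalizedModule.mk_cancel (⟨X ^ (k + 1), k + 1, rfl⟩ : Sx) (f a)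
    rw [smul_sub, ha, h, map_smul, map_sub, map_smul, map_neg, ← X_smul_jmap c]
    module

end Flavours

lemma exists_eq_X_smul_of_torsion_eval_eq_zero {N : Type} [AddCommGroup N] [Module Rp N]
    [Module.Free Rp N] [Module.Finite Rp N] (S : Submodule Rp N) (ψ : Module.Dual Rp N)
    (h : ∀ (k : ℕ) (c : N), (X ^ k : Rp) • c ∈ S → (ψ c).eval 0 = 0) :
    ∃ θ : Module.Dual Rp N, ∀ x ∈ S, ψ x = (X : Rp) • θ x := by
  obtain ⟨r, ⟨bN, bS, i, a, hi⟩⟩ := S.smithNormalForm (Module.Free.chooseBasis Rp N)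
  let θ : Module.Dual Rp N := bN.constr Rp fun j => (ψ (bN j)).divX
  refine ⟨θ, fun x hx => ?_⟩
  suffices ψ ∘ₗ S.subtype = ((X : Rp) • θ) ∘ₗ S.subtype from LinearMap.congr_fun this ⟨x, hx⟩
  refine bS.ext fun j => ?_
  have hθ : θ (bN (i j)) = (ψ (bN (i j))).divX := bN.constr_basis ..
  simp only [LinearMap.comp_apply, Submodule.subtype_apply, hi, map_smul,
    LinearMap.smul_apply, hθ]
  rcases eq_or_ne (a j) 0 with ha | ha
  · simp [ha]
  obtain ⟨u, hu, hXu⟩ := (a j).exists_eq_pow_rootMultiplicity_mul_and_not_dvd ha 0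
  rw [map_zero, sub_zero] at hu hXu
  have hψu := h ((a j).rootMultiplicity 0) (u • bN (i j)) (by
    rw [smul_smul, ← hu, ← hi]
    exact (bS j).2)
  rw [map_smul, smul_eq_mul, eval_mul, mul_eq_zero, or_iff_right] at hψu
  · congr 1
    conv_lhs => rw [← X_mul_divX_add (ψ (bN (i j)))]
    rw [coeff_zero_eq_eval_zero, hψu, map_zero, add_zero, smul_eq_mul]
  · rwa [X_dvd_iff, coeff_zero_eq_eval_zero] at hXu

/-- Let `F = ℤ/2ℤ`, `R = F[U]`, and let `C` be a bounded chain complex of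
finitely generated free `R`-modules (with differential `d n : C (n+1) → C n`).  Form
`C^∞ = C[U⁻¹]`, `C⁺ = C^∞/C` and `Ĉ = C/UC` degreewise, with the induced differentials,
the map `ι̂_C` on homology induced by the chain map `Ĉ → C⁺`, `c + UC ↦ U⁻¹c + C`, and
`H_red = coker (H(C^∞) → H(C⁺))`.  Let `D = Hom_R(C, R)` be the `R`-dual complex, with the
analogous constructions, and let `⟨·,·⟩` be the Kronecker pairing induced by
`D/UD ≅ Hom_F(C/UC, F)` (at chain level, `⟨ψ, c⟩ = (ψ c)(0) ∈ F`).  Then for every class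
`x ∈ H_*(D̂)` (represented by a cocycle `ψ̄ = ψ + UD`): the image of `ι̂_D(x)` in `H_red(D)`
is nonzero if and only if there is a class `y ∈ H_*(Ĉ)` (represented by a cycle
`c + UC`) with `⟨x, y⟩ ≠ 0` and `ι̂_C(y) = 0` in `H_*(C⁺)`.

(Homology in degree `n+1` uses the window `n+2, n+1, n`; quantifying over all `n : ℤ`
covers all degrees.) -/
theorem stmt3
    (C : ℤ → Type) [∀ n, AddCommGroup (C n)] [∀ n, Module Rp (C n)]
    [∀ n, Module.Free Rp (C n)] [∀ n, Module.Finite Rp (C n)]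
    (d : ∀ n : ℤ, C (n + 1) →ₗ[Rp] C n)
    (hd : ∀ n : ℤ, d n ∘ₗ d (n + 1) = 0)
    (hbounded : ∃ a b : ℤ, ∀ n : ℤ, (n < a ∨ b < n) → ∀ x : C n, x = 0)
    (n : ℤ)
    (ψ : Module.Dual Rp (C (n + 1)))
    (hψ : (Submodule.Quotient.mk ψ : CHat (Module.Dual Rp (C (n + 1)))) ∈
      LinearMap.ker (hatMap ((d (n + 1)).dualMap))) :
    HmodMap (d1 := hatMap ((d n).dualMap)) (d0 := hatMap ((d (n + 1)).dualMap))
        (d1' := plusMap ((d n).dualMap)) (d0' := plusMap ((d (n + 1)).dualMap))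
        iotaHat iotaHat iotaHat
        (iota_square ((d n).dualMap)) (iota_square ((d (n + 1)).dualMap))
        (Hmod.mk (hatMap ((d n).dualMap)) (hatMap ((d (n + 1)).dualMap))
          (Submodule.Quotient.mk ψ) hψ) ∉
      LinearMap.range (HmodMap
        (d1 := locMap ((d n).dualMap)) (d0 := locMap ((d (n + 1)).dualMap))
        (d1' := plusMap ((d n).dualMap)) (d0' := plusMap ((d (n + 1)).dualMap))
        (projPlus _) (projPlus _) (projPlus _)
        (proj_square ((d n).dualMap)) (proj_square ((d (n + 1)).dualMap)))
    ↔ ∃ (c : C (n + 1))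
        (hc : (Submodule.Quotient.mk c : CHat (C (n + 1))) ∈ LinearMap.ker (hatMap (d n))),
        Polynomial.eval (0 : ZMod 2) (ψ c) ≠ 0 ∧
        HmodMap (d1 := hatMap (d (n + 1))) (d0 := hatMap (d n))
          (d1' := plusMap (d (n + 1))) (d0' := plusMap (d n))
          iotaHat iotaHat iotaHat (iota_square (d (n + 1))) (iota_square (d n))
          (Hmod.mk (hatMap (d (n + 1))) (hatMap (d n)) (Submodule.Quotient.mk c) hc) = 0 := by
  have hdual : (d (n + 1)).dualMap ∘ₗ (d n).dualMap = 0 := by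
    rw [LinearMap.dualMap_comp_dualMap, hd]
    ext
    simp
  rw [iotaHat_mem_range_iff _ _ hdual]
  constructor
  · intro hθ
    contrapose! hθ
    obtain ⟨θ, h⟩ := exists_eq_X_smul_of_torsion_eval_eq_zero
      (LinearMap.range (d (n + 1))) ψ (by
        rintro k c ⟨a, ha⟩
        have hgc : d n c = 0 := by
          refine smul_right_injective _ (pow_ne_zero k (X_ne_zero (R := ZMod 2))) ?_
          change (X ^ k : Rp) • d n c = (X ^ k : Rp) • 0
          rw [smul_zero, ← map_smul, ← ha, ← LinearMap.comp_apply, hd, LinearMap.zero_apply]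
        have hc : (Submodule.Quotient.mk c : CHat (C (n + 1))) ∈
            LinearMap.ker (hatMap (d n)) := by
          rw [LinearMap.mem_ker, hatMap, Submodule.mapQ_apply, hgc,
            Submodule.Quotient.mk_zero]
        by_contra hψc
        refine hθ c hc hψc ((iotaHat_eq_zero_iff _ _ c hc).mpr ⟨k, 0, a, ?_⟩)
        rw [smul_zero, sub_zero, ha])
    refine ⟨θ, LinearMap.ext fun a => ?_⟩
    rw [LinearMap.dualMap_apply, LinearMap.sub_apply, LinearMap.smul_apply,
      h _ ⟨a, rfl⟩, sub_self, LinearMap.zero_apply]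
  · rintro ⟨c, hc, hψc, h0⟩ ⟨θ, hθ⟩
    obtain ⟨k, b, a, ha⟩ := (iotaHat_eq_zero_iff _ _ c hc).mp h0
    have h := LinearMap.congr_fun hθ a
    rw [LinearMap.dualMap_apply, ha, map_smul, LinearMap.zero_apply, smul_eq_zero,
      or_iff_right (pow_ne_zero k X_ne_zero), LinearMap.sub_apply, sub_eq_zero, map_sub,
      map_smul, LinearMap.smul_apply, sub_eq_iff_eq_add] at h
    rw [h] at hψc
    simp at hψc
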